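/- (Theorem 1.5(i).) Let n ≥ 2 and let β ≥ 0 be a real number. A real number ς is an eigenvalue of the Wentzell bi-Laplace problem on the unit ball — i.e., there exists a nonzero smooth function u on an open set containing the closed unit ball with Δ²u = 0 on 𝔹, ℰu = 0 on ∂𝔹, and ℰ(Δu) + β(Δu − ℰ²u) + ς·u = 0 on ∂𝔹 — if and only if ς = k²(n + 2k) + βk(k + n − 2) for some nonnegative integer k. -/

import Mathlib

/-- The Euclidean Laplacian `Δf(x) = ∑ i, ∂²f/∂xᵢ²(x)`. -/
noncomputable def lap {n : ℕ} (f : EuclideanSpace ℝ (Fin n) → ℝ)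
    (x : EuclideanSpace ℝ (Fin n)) : ℝ :=
  ∑ i : Fin n,
    fderiv ℝ (fun y => fderiv ℝ f y (EuclideanSpace.single i 1)) x (EuclideanSpace.single i 1)

/-- The Euler operator `ℰf(x) = ∑ i, xᵢ ∂f/∂xᵢ(x) = ⟨x, ∇f(x)⟩ = df_x(x)`. -/
noncomputable def euler {n : ℕ} (f : EuclideanSpace ℝ (Fin n) → ℝ)
    (x : EuclideanSpace ℝ (Fin n)) : ℝ :=
  fderiv ℝ f x x


open scoped ContDiff
open Set Metric

section ParametricIntegral

variable {E : Type*} [NormedAddCommGroup E] [NormedSpace ℝ E] [ProperSpace E]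

theorem hasFDerivAt_parametric_intervalIntegral {G : Type*} [NormedAddCommGroup G]
    [NormedSpace ℝ G] {F : E × ℝ → G} (hF : ContDiff ℝ ∞ F) (a b : ℝ) (x : E) :
    HasFDerivAt (fun x => ∫ s in a..b, F (x, s))
      (∫ s in a..b, (fderiv ℝ F (x, s)).comp (ContinuousLinearMap.inl ℝ E ℝ)) x := by
  have hF' : Continuous fun p : E × ℝ => (fderiv ℝ F p).comp (ContinuousLinearMap.inl ℝ E ℝ) :=
    (hF.continuous_fderiv (by simp)).clm_comp continuous_const
  obtain ⟨C, hC⟩ := ((isCompact_closedBall x 1).prod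
    (isCompact_uIcc (a := a) (b := b))).exists_bound_of_continuousOn hF'.continuousOn
  refine intervalIntegral.hasFDerivAt_integral_of_dominated_of_fderiv_le
    (F' := fun x s => (fderiv ℝ F (x, s)).comp (ContinuousLinearMap.inl ℝ E ℝ))
    (bound := fun _ => C) (closedBall_mem_nhds x one_pos) ?_ ?_ ?_ ?_ ?_ ?_
  · exact .of_forall fun y => (hF.continuous.comp (by fun_prop)).aestronglyMeasurable
  · exact (hF.continuous.comp (by fun_prop : Continuous fun s : ℝ => (x, s))).intervalIntegrable _ _
  · exact (hF'.comp (by fun_prop : Continuous fun s : ℝ => (x, s))).aestronglyMeasurable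
  · exact .of_forall fun s hs y hy => hC (y, s) ⟨hy, uIoc_subset_uIcc hs⟩
  · exact intervalIntegrable_const
  · refine .of_forall fun s _ y _ => ?_
    exact ((hF.differentiable (by simp) (y, s)).hasFDerivAt).comp y (hasFDerivAt_prodMk_left y s)

theorem ContDiff.parametric_intervalIntegral {E : Type} [NormedAddCommGroup E] [NormedSpace ℝ E]
    [ProperSpace E] {G : Type} [NormedAddCommGroup G] [NormedSpace ℝ G]
    {F : E × ℝ → G} (hF : ContDiff ℝ ∞ F) (a b : ℝ) :
    ContDiff ℝ ∞ fun x => ∫ s in a..b, F (x, s) := by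
  refine contDiff_infty.2 fun m => ?_
  induction m generalizing G with
  | zero =>
    exact contDiff_zero.2 (continuous_iff_continuousAt.2 fun x =>
      (hasFDerivAt_parametric_intervalIntegral hF a b x).continuousAt)
  | succ m ih =>
    push_cast
    refine contDiff_succ_iff_fderiv.2 ⟨fun x =>
      (hasFDerivAt_parametric_intervalIntegral hF a b x).differentiableAt, by simp, ?_⟩
    rw [funext fun x => (hasFDerivAt_parametric_intervalIntegral hF a b x).fderiv]
    exact ih (F := fun p => (fderiv ℝ F p).comp (ContinuousLinearMap.inl ℝ E ℝ))
      ((contDiff_infty_iff_fderiv.1 hF).2.clm_comp contDiff_const)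

end ParametricIntegral

section EulerSystem

variable {F : Type*} [NormedAddCommGroup F] [InnerProductSpace ℝ F]

theorem eqOn_zero_of_smul_deriv_eq_of_inner_le (m : ℕ) (A : F →L[ℝ] F)
    (hA : ∀ (j : ℕ) (v : F), A v = (j : ℝ) • v → v = 0)
    (hm : ∀ v, inner ℝ v (A v) ≤ m * ‖v‖ ^ 2) {φ : ℝ → F} (hφ : ContDiff ℝ ∞ φ)
    (h : ∀ t ∈ Ioo (-1 : ℝ) 1, t • deriv φ t = A (φ t)) :
    ∀ t ∈ Ico (0 : ℝ) 1, φ t = 0 := by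
  have hd : Differentiable ℝ φ := hφ.differentiable (by simp)
  induction m generalizing A φ with
  | zero =>
    have h0 : φ 0 = 0 := hA 0 _ (by simpa using (h 0 (by simp)).symm)
    have hder : ∀ t, HasDerivAt (fun t => ‖φ t‖ ^ 2) (2 * inner ℝ (φ t) (deriv φ t)) t :=
      fun t => (hd t).hasDerivAt.norm_sq
    have hanti : AntitoneOn (fun t => ‖φ t‖ ^ 2) (Ico (0 : ℝ) 1) := by
      refine antitoneOn_of_deriv_nonpos (convex_Ico 0 1)
        (fun t _ => (hder t).continuousAt.continuousWithinAt)
        (fun t _ => (hder t).differentiableAt.differentiableWithinAt) fun t ht => ?_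
      rw [interior_Ico] at ht
      rw [(hder t).deriv]
      have h1 := hm (φ t)
      rw [← h t ⟨by linarith [ht.1], ht.2⟩, inner_smul_right] at h1
      have := nonpos_of_mul_nonpos_right (by simpa using h1) ht.1
      linarith
    intro t ht
    have := hanti (left_mem_Ico.2 one_pos) ht ht.1
    simp only [h0, norm_zero] at this
    simpa using le_antisymm (by simpa using this) (sq_nonneg ‖φ t‖)
  | succ m ih =>
    have hφ' : ContDiff ℝ ∞ (deriv φ) := (contDiff_infty_iff_deriv.1 hφ).2
    have hd' : Differentiable ℝ (deriv φ) := hφ'.differentiable (by simp)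
    have key : ∀ t ∈ Ico (0 : ℝ) 1, deriv φ t = 0 := by
      refine ih (A - ContinuousLinearMap.id ℝ F) (fun j v hv => hA (j + 1) v ?_) (fun v => ?_)
        hφ' (fun t ht => ?_) hd'
      · simp only [sub_apply, ContinuousLinearMap.id_apply] at hv
        push_cast
        rw [add_smul, one_smul, ← hv, sub_add_cancel]
      · have := hm v
        push_cast at this
        simp only [sub_apply, ContinuousLinearMap.id_apply, inner_sub_right,
          real_inner_self_eq_norm_sq]
        linarith
      · have h1 : HasDerivAt (fun t => t • deriv φ t)
            (t • deriv (deriv φ) t + (1 : ℝ) • deriv φ t) t :=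
          (hasDerivAt_id t).smul (hd' t).hasDerivAt
        have h2 : HasDerivAt (fun t => A (φ t)) (A (deriv φ t)) t :=
          A.hasFDerivAt.comp_hasDerivAt t (hd t).hasDerivAt
        have h3 : (fun t => t • deriv φ t) =ᶠ[nhds t] fun t => A (φ t) :=
          Filter.eventually_of_mem (isOpen_Ioo.mem_nhds ht) h
        have h4 := h1.unique (h2.congr_of_eventuallyEq h3)
        simp only [sub_apply, ContinuousLinearMap.id_apply, ← h4]
        module
    intro t ht
    refine hA 0 _ ?_
    rw [← h t ⟨by linarith [ht.1], ht.2⟩, key t ht]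
    simp

theorem eqOn_ball_zero_of_fderiv_apply_self_eq {E : Type*} [NormedAddCommGroup E] [NormedSpace ℝ E]
    (A : F →L[ℝ] F) (hA : ∀ (j : ℕ) (v : F), A v = (j : ℝ) • v → v = 0)
    {V : E → F} (hV : ContDiff ℝ ∞ V) (h : ∀ x ∈ ball (0 : E) 1, fderiv ℝ V x x = A (V x)) :
    ∀ x ∈ ball (0 : E) 1, V x = 0 := by
  intro x hx
  rw [mem_ball_zero_iff] at hx
  set y : E := ‖x‖⁻¹ • x with hy
  have hxy : ‖x‖ • y = x := by
    rcases eq_or_ne x 0 with rfl | hx0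
    · simp
    · rw [hy, smul_inv_smul₀ (norm_ne_zero_iff.2 hx0)]
  have hy1 : ‖y‖ ≤ 1 := by
    rw [hy, norm_smul, norm_inv, norm_norm]
    exact inv_mul_le_one
  obtain ⟨m, hm⟩ := exists_nat_ge ‖A‖
  rw [← hxy]
  refine eqOn_zero_of_smul_deriv_eq_of_inner_le m A hA (fun v => ?_)
    (φ := fun t => V (t • y)) (hV.comp (contDiff_id.smul contDiff_const)) (fun t ht => ?_)
    ‖x‖ ⟨norm_nonneg x, hx⟩
  · calc inner ℝ v (A v) ≤ ‖v‖ * ‖A v‖ := real_inner_le_norm _ _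
      _ ≤ ‖v‖ * (‖A‖ * ‖v‖) := by gcongr; exact A.le_opNorm v
      _ = ‖A‖ * ‖v‖ ^ 2 := by ring
      _ ≤ m * ‖v‖ ^ 2 := by gcongr
  · have hd : HasDerivAt (fun t : ℝ => V (t • y)) (fderiv ℝ V (t • y) y) t := by
      have h1 : HasDerivAt (fun t : ℝ => t • y) y t := by
        simpa using (hasDerivAt_id t).smul_const y
      exact ((hV.differentiable (by simp) (t • y)).hasFDerivAt).comp_hasDerivAt t h1
    rw [hd.deriv, ← map_smul]
    refine h _ ?_
    rw [mem_ball_zero_iff, norm_smul, Real.norm_eq_abs]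
    calc |t| * ‖y‖ ≤ |t| * 1 := by gcongr
      _ < 1 := by rw [mul_one]; exact abs_lt.2 ht

end EulerSystem

section Operators

variable {n : ℕ} {f g : EuclideanSpace ℝ (Fin n) → ℝ}

theorem ContDiff.fderiv_apply_const {E : Type*} [NormedAddCommGroup E] [NormedSpace ℝ E]
    {f : E → ℝ} (hf : ContDiff ℝ ∞ f) (v : E) : ContDiff ℝ ∞ fun y => fderiv ℝ f y v :=
  (contDiff_infty_iff_fderiv.1 hf).2.clm_apply contDiff_const

theorem ContDiff.euler (hf : ContDiff ℝ ∞ f) : ContDiff ℝ ∞ (euler f) :=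
  (contDiff_infty_iff_fderiv.1 hf).2.clm_apply contDiff_id

theorem ContDiff.lap (hf : ContDiff ℝ ∞ f) : ContDiff ℝ ∞ (lap f) :=
  ContDiff.sum fun i _ => (hf.fderiv_apply_const (EuclideanSpace.single i 1)).fderiv_apply_const _

theorem Filter.EventuallyEq.euler {x : EuclideanSpace ℝ (Fin n)} (h : f =ᶠ[nhds x] g) :
    euler f =ᶠ[nhds x] euler g :=
  (h.fderiv (𝕜 := ℝ)).mono fun y hy => by simp only [_root_.euler, hy]

theorem Filter.EventuallyEq.lap {x : EuclideanSpace ℝ (Fin n)} (h : f =ᶠ[nhds x] g) :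
    lap f =ᶠ[nhds x] lap g := by
  refine (Filter.eventually_all.2 fun i => ?_ : ∀ᶠ y in nhds x, ∀ i : Fin n,
    fderiv ℝ (fun y => fderiv ℝ f y (EuclideanSpace.single i 1)) y =
      fderiv ℝ (fun y => fderiv ℝ g y (EuclideanSpace.single i 1)) y).mono fun y hy => by
        simp only [_root_.lap, hy]
  have h' : (fun y => fderiv ℝ f y (EuclideanSpace.single i 1)) =ᶠ[nhds x]
      fun y => fderiv ℝ g y (EuclideanSpace.single i 1) :=
    (h.fderiv (𝕜 := ℝ)).mono fun y hy => by simp only [hy]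
  exact h'.fderiv

theorem euler_add (hf : ContDiff ℝ ∞ f) (hg : ContDiff ℝ ∞ g) :
    euler (fun x => f x + g x) = fun x => euler f x + euler g x := by
  funext x
  simp only [euler]
  rw [fderiv_fun_add (hf.differentiable (by simp) x) (hg.differentiable (by simp) x)]
  rfl

theorem euler_const_mul (c : ℝ) (hf : ContDiff ℝ ∞ f) :
    euler (fun x => c * f x) = fun x => c * euler f x := by
  funext x
  simp only [euler]
  rw [fderiv_const_mul (hf.differentiable (by simp) x)]
  rfl

theorem euler_mul (hf : ContDiff ℝ ∞ f) (hg : ContDiff ℝ ∞ g) :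
    euler (fun x => f x * g x) = fun x => f x * euler g x + g x * euler f x := by
  funext x
  simp only [euler]
  rw [fderiv_fun_mul (hf.differentiable (by simp) x) (hg.differentiable (by simp) x)]
  rfl

theorem lap_add (hf : ContDiff ℝ ∞ f) (hg : ContDiff ℝ ∞ g) :
    lap (fun x => f x + g x) = fun x => lap f x + lap g x := by
  funext x
  simp only [lap, ← Finset.sum_add_distrib]
  refine Finset.sum_congr rfl fun i _ => ?_
  set e : EuclideanSpace ℝ (Fin n) := EuclideanSpace.single i 1
  rw [show (fun y => fderiv ℝ (fun x => f x + g x) y e) = fun y => fderiv ℝ f y e + fderiv ℝ g y e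
    from funext fun y => by
      rw [fderiv_fun_add (hf.differentiable (by simp) y) (hg.differentiable (by simp) y)]; rfl]
  rw [fderiv_fun_add ((hf.fderiv_apply_const e).differentiable (by simp) x)
    ((hg.fderiv_apply_const e).differentiable (by simp) x)]
  rfl

theorem lap_const_mul (c : ℝ) (hf : ContDiff ℝ ∞ f) :
    lap (fun x => c * f x) = fun x => c * lap f x := by
  funext x
  simp only [lap, Finset.mul_sum]
  refine Finset.sum_congr rfl fun i _ => ?_
  set e : EuclideanSpace ℝ (Fin n) := EuclideanSpace.single i 1
  rw [show (fun y => fderiv ℝ (fun x => c * f x) y e) = fun y => c * fderiv ℝ f y e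
    from funext fun y => by rw [fderiv_const_mul (hf.differentiable (by simp) y)]; rfl]
  rw [fderiv_const_mul ((hf.fderiv_apply_const e).differentiable (by simp) x)]
  rfl

theorem lap_mul (hf : ContDiff ℝ ∞ f) (hg : ContDiff ℝ ∞ g) :
    lap (fun x => f x * g x) = fun x => f x * lap g x + g x * lap f x +
      2 * ∑ i, fderiv ℝ f x (EuclideanSpace.single i 1) *
        fderiv ℝ g x (EuclideanSpace.single i 1) := by
  funext x
  simp only [lap, Finset.mul_sum, ← Finset.sum_add_distrib]
  refine Finset.sum_congr rfl fun i _ => ?_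
  set e : EuclideanSpace ℝ (Fin n) := EuclideanSpace.single i 1
  have df := hf.differentiable (by simp)
  have dg := hg.differentiable (by simp)
  have df' := (hf.fderiv_apply_const e).differentiable (by simp)
  have dg' := (hg.fderiv_apply_const e).differentiable (by simp)
  rw [show (fun y => fderiv ℝ (fun x => f x * g x) y e) =
      fun y => f y * fderiv ℝ g y e + g y * fderiv ℝ f y e
    from funext fun y => by rw [fderiv_fun_mul (df y) (dg y)]; rfl]
  rw [fderiv_fun_add ((df x).fun_mul (dg' x)) ((dg x).fun_mul (df' x)),
    fderiv_fun_mul (df x) (dg' x), fderiv_fun_mul (dg x) (df' x)]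
  simp only [add_apply, smul_apply, smul_eq_mul]
  ring

theorem fderiv_euler_apply (hf : ContDiff ℝ ∞ f) (v : EuclideanSpace ℝ (Fin n)) :
    (fun x => fderiv ℝ (euler f) x v) =
      fun x => euler (fun y => fderiv ℝ f y v) x + fderiv ℝ f x v := by
  funext x
  have d : Differentiable ℝ (fderiv ℝ f) :=
    (contDiff_infty_iff_fderiv.1 hf).2.differentiable (by simp)
  have h1 : HasFDerivAt (euler f) _ x := (d x).hasFDerivAt.clm_apply (hasFDerivAt_id x)
  have h2 : HasFDerivAt (fun y => fderiv ℝ f y v) _ x :=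
    (d x).hasFDerivAt.clm_apply (hasFDerivAt_const v x)
  have hs : fderiv ℝ (fderiv ℝ f) x v x = fderiv ℝ (fderiv ℝ f) x x v :=
    (hf.contDiffAt.isSymmSndFDerivAt (by
      simpa using WithTop.coe_le_coe.2 (le_top : (2 : ℕ∞) ≤ ⊤))) v x
  rw [euler, h1.fderiv, h2.fderiv]
  simp [hs, add_comm]

theorem lap_euler (hf : ContDiff ℝ ∞ f) :
    lap (euler f) = fun x => euler (lap f) x + 2 * lap f x := by
  funext x
  have he : euler (lap f) x = ∑ i : Fin n, euler (fun x =>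
      fderiv ℝ (fun y => fderiv ℝ f y (EuclideanSpace.single i 1)) x
        (EuclideanSpace.single i 1)) x := by
    simp only [euler]
    rw [show lap f = fun x => ∑ i : Fin n, fderiv ℝ (fun y => fderiv ℝ f y
      (EuclideanSpace.single i 1)) x (EuclideanSpace.single i 1) from rfl,
      fderiv_fun_sum fun i _ => ((hf.fderiv_apply_const _).fderiv_apply_const
        _).differentiable (by simp) x]
    simp
  rw [he, lap, lap, Finset.mul_sum, ← Finset.sum_add_distrib]
  refine Finset.sum_congr rfl fun i _ => ?_
  set e : EuclideanSpace ℝ (Fin n) := EuclideanSpace.single i 1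
  have hfe := hf.fderiv_apply_const e
  rw [fderiv_euler_apply hf e, fderiv_fun_add (hfe.euler.differentiable (by simp) x)
    (hfe.differentiable (by simp) x), add_apply,
    congrFun (fderiv_euler_apply hfe e) x]
  ring

theorem contDiff_one_sub_norm_sq :
    ContDiff ℝ ∞ fun x : EuclideanSpace ℝ (Fin n) => 1 - ‖x‖ ^ 2 :=
  contDiff_const.sub (contDiff_norm_sq ℝ)

theorem fderiv_one_sub_norm_sq_apply (x v : EuclideanSpace ℝ (Fin n)) :
    fderiv ℝ (fun x : EuclideanSpace ℝ (Fin n) => 1 - ‖x‖ ^ 2) x v = -2 * inner ℝ x v := by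
  rw [fderiv_const_sub, fderiv_norm_sq_apply]
  simp

theorem lap_one_sub_norm_sq :
    lap (fun x : EuclideanSpace ℝ (Fin n) => 1 - ‖x‖ ^ 2) = fun _ => -2 * (n : ℝ) := by
  funext x
  have h : ∀ i : Fin n, fderiv ℝ (fun y : EuclideanSpace ℝ (Fin n) =>
      -2 * inner ℝ y (EuclideanSpace.single i (1 : ℝ))) x (EuclideanSpace.single i 1) = -2 := by
    intro i
    rw [fderiv_const_mul (differentiableAt_fun_id.inner ℝ (differentiableAt_const _)), smul_apply,
      fderiv_inner_apply ℝ differentiableAt_fun_id (differentiableAt_const _)]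
    simp
  simp only [lap, fderiv_one_sub_norm_sq_apply, h]
  simp [mul_comm]

theorem euler_one_sub_norm_sq :
    euler (fun x : EuclideanSpace ℝ (Fin n) => 1 - ‖x‖ ^ 2) = fun x => -2 * ‖x‖ ^ 2 := by
  funext x
  rw [euler, fderiv_one_sub_norm_sq_apply, real_inner_self_eq_norm_sq]

theorem lap_one_sub_norm_sq_mul (hf : ContDiff ℝ ∞ f) :
    lap (fun x => (1 - ‖x‖ ^ 2) * f x) =
      fun x => (1 - ‖x‖ ^ 2) * lap f x - 2 * n * f x - 4 * euler f x := by
  rw [lap_mul contDiff_one_sub_norm_sq hf]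
  funext x
  have hx : euler f x = ∑ i, x i * fderiv ℝ f x (EuclideanSpace.single i 1) := by
    rw [euler]
    conv_lhs => arg 2; rw [← (EuclideanSpace.basisFun (Fin n) ℝ).sum_repr x]
    simp only [map_sum, map_smul, EuclideanSpace.basisFun_repr, EuclideanSpace.basisFun_apply,
      smul_eq_mul]
  simp only [fderiv_one_sub_norm_sq_apply, lap_one_sub_norm_sq, hx]
  simp only [EuclideanSpace.inner_single_right, Finset.mul_sum, mul_assoc]
  simp
  simp only [← Finset.mul_sum]
  ring

theorem euler_one_sub_norm_sq_mul (hf : ContDiff ℝ ∞ f) :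
    euler (fun x => (1 - ‖x‖ ^ 2) * f x) =
      fun x => (1 - ‖x‖ ^ 2) * euler f x - 2 * ‖x‖ ^ 2 * f x := by
  rw [euler_mul contDiff_one_sub_norm_sq hf, euler_one_sub_norm_sq]
  funext x
  ring

theorem euler_euler_one_sub_norm_sq_mul (hf : ContDiff ℝ ∞ f)
    {x : EuclideanSpace ℝ (Fin n)} (hx : ‖x‖ = 1) :
    euler (euler fun x => (1 - ‖x‖ ^ 2) * f x) x = -4 * euler f x - 4 * f x := by
  have h : (euler fun x => (1 - ‖x‖ ^ 2) * f x) =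
      fun x => (1 - ‖x‖ ^ 2) * (euler f x + 2 * f x) + (-2) * f x := by
    rw [euler_one_sub_norm_sq_mul hf]
    funext x
    ring
  have hf' : ContDiff ℝ ∞ fun x => euler f x + 2 * f x := hf.euler.add (contDiff_const.mul hf)
  rw [h, euler_add (contDiff_one_sub_norm_sq.mul hf') (contDiff_const.mul hf),
    euler_one_sub_norm_sq_mul hf', euler_const_mul _ hf]
  simp only [hx]
  ring

end Operators

section MaximumPrinciple

variable {n : ℕ} {f : EuclideanSpace ℝ (Fin n) → ℝ}

theorem lap_nonpos_of_isLocalMax (hf : ContDiff ℝ ∞ f) {x : EuclideanSpace ℝ (Fin n)}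
    (hx : IsLocalMax f x) : lap f x ≤ 0 := by
  refine Finset.sum_nonpos fun i _ => ?_
  set e : EuclideanSpace ℝ (Fin n) := EuclideanSpace.single i 1
  by_contra! hpos
  have hline : ∀ t : ℝ, HasDerivAt (fun t : ℝ => x + t • e) e t := fun t => by
    simpa using ((hasDerivAt_id t).smul_const e).const_add x
  have hd : ∀ {g : EuclideanSpace ℝ (Fin n) → ℝ}, ContDiff ℝ ∞ g →
      deriv (fun t : ℝ => g (x + t • e)) = fun t => fderiv ℝ g (x + t • e) e := fun hg =>
    funext fun t => ((hg.differentiable (by simp) _).hasFDerivAt.comp_hasDerivAt t (hline t)).deriv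
  have hd1 := hd hf
  have hd2 := hd (hf.fderiv_apply_const e)
  have hc : ContinuousAt (fun t : ℝ => x + t • e) 0 := (hline 0).continuousAt
  have hmax : IsLocalMax (fun t : ℝ => f (x + t • e)) 0 := by
    have : IsLocalMax f (x + (0 : ℝ) • e) := by simpa using hx
    exact IsLocalMax.comp_continuous (g := fun t : ℝ => x + t • e) this hc
  have hmin : IsLocalMin (fun t : ℝ => f (x + t • e)) 0 := by
    refine isLocalMin_of_deriv_deriv_pos ?_ hmax.deriv_eq_zero
      (hf.continuous.continuousAt.comp hc)
    rw [hd1, hd2]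
    simpa using hpos
  have hconst : (fun t : ℝ => f (x + t • e)) =ᶠ[nhds 0] fun _ => f x := by
    filter_upwards [hmax, hmin] with t h1 h2
    simpa using le_antisymm h1 h2
  have := hconst.deriv.deriv_eq
  rw [hd1, hd2] at this
  simp at this
  exact hpos.ne' this

theorem nonpos_on_closedBall_of_lap_eq_zero (hf : ContDiff ℝ ∞ f) (hn : 0 < n)
    (hlap : ∀ x ∈ ball (0 : EuclideanSpace ℝ (Fin n)) 1, lap f x = 0)
    (hbd : ∀ x : EuclideanSpace ℝ (Fin n), ‖x‖ = 1 → f x = 0) :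
    ∀ x ∈ closedBall (0 : EuclideanSpace ℝ (Fin n)) 1, f x ≤ 0 := by
  intro x hx
  refine le_of_forall_pos_le_add fun ε hε => ?_
  rw [zero_add]
  set g : EuclideanSpace ℝ (Fin n) → ℝ := fun x => f x + (-ε) * (1 - ‖x‖ ^ 2) with hgdef
  have hb : ContDiff ℝ ∞ fun x : EuclideanSpace ℝ (Fin n) => (-ε) * (1 - ‖x‖ ^ 2) :=
    contDiff_const.mul contDiff_one_sub_norm_sq
  have hg : ContDiff ℝ ∞ g := hf.add hb
  obtain ⟨z, hz, hmax⟩ := (isCompact_closedBall (0 : EuclideanSpace ℝ (Fin n)) 1).exists_isMaxOn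
    ⟨x, hx⟩ hg.continuous.continuousOn
  have hz1 : ‖z‖ = 1 := by
    by_contra hne
    have hzb : z ∈ ball (0 : EuclideanSpace ℝ (Fin n)) 1 :=
      mem_ball_zero_iff.2 (lt_of_le_of_ne (mem_closedBall_zero_iff.1 hz) hne)
    have h1 := lap_nonpos_of_isLocalMax hg (hmax.isLocalMax
      (Filter.mem_of_superset (isOpen_ball.mem_nhds hzb) ball_subset_closedBall))
    rw [hgdef, lap_add hf hb, lap_const_mul _ contDiff_one_sub_norm_sq,
      lap_one_sub_norm_sq] at h1
    simp only [hlap z hzb] at h1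
    have : 0 < ε * n := by positivity
    linarith
  have h2 : g x ≤ g z := hmax hx
  simp only [hgdef, hbd z hz1, hz1] at h2
  nlinarith [mul_nonneg hε.le (sq_nonneg ‖x‖)]

theorem eqOn_closedBall_zero_of_lap_eq_zero (hf : ContDiff ℝ ∞ f) (hn : 0 < n)
    (hlap : ∀ x ∈ ball (0 : EuclideanSpace ℝ (Fin n)) 1, lap f x = 0)
    (hbd : ∀ x : EuclideanSpace ℝ (Fin n), ‖x‖ = 1 → f x = 0) :
    ∀ x ∈ closedBall (0 : EuclideanSpace ℝ (Fin n)) 1, f x = 0 := by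
  intro x hx
  refine le_antisymm (nonpos_on_closedBall_of_lap_eq_zero hf hn hlap hbd x hx) ?_
  have := nonpos_on_closedBall_of_lap_eq_zero (f := fun x => (-1) * f x) (contDiff_const.mul hf) hn
    (fun y hy => by rw [lap_const_mul _ hf]; simp [hlap y hy])
    (fun y hy => by simp [hbd y hy]) x hx
  linarith

end MaximumPrinciple

section Decomposition

variable {n : ℕ}

theorem exists_contDiff_mul_add_two_mul_euler_eq (hn : 0 < n)
    {w : EuclideanSpace ℝ (Fin n) → ℝ} (hw : ContDiff ℝ ∞ w) :
    ∃ q, ContDiff ℝ ∞ q ∧ ∀ x, n * q x + 2 * euler q x = w x := by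
  set F : EuclideanSpace ℝ (Fin n) × ℝ → ℝ := fun p => p.2 ^ (n - 1) * w (p.2 ^ 2 • p.1) with hFdef
  have hF : ContDiff ℝ ∞ F :=
    (contDiff_snd.pow _).mul (hw.comp ((contDiff_snd.pow 2).smul contDiff_fst))
  refine ⟨fun x => ∫ s in (0 : ℝ)..1, F (x, s), hF.parametric_intervalIntegral 0 1, fun x => ?_⟩
  have dw : Differentiable ℝ w := hw.differentiable (by simp)
  have hcw : Continuous (fderiv ℝ w) := hw.continuous_fderiv (by simp)
  have hpart : ∀ s : ℝ, fderiv ℝ F (x, s) (x, 0) =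
      s ^ (n - 1) * (s ^ 2 * fderiv ℝ w (s ^ 2 • x) x) := fun s => by
    have h1 := HasFDerivAt.comp (g := F) (f := fun y => (y, s)) x
      ((hF.differentiable (by simp) (x, s)).hasFDerivAt) (hasFDerivAt_prodMk_left x s)
    have h2 : HasFDerivAt (fun y => F (y, s)) _ x :=
      ((dw (s ^ 2 • x)).hasFDerivAt.comp x ((hasFDerivAt_id x).const_smul (s ^ 2))).const_mul
        (s ^ (n - 1))
    simpa using DFunLike.congr_fun (h1.unique h2) x
  have hcont : Continuous fun s : ℝ =>
      (fderiv ℝ F (x, s)).comp (ContinuousLinearMap.inl ℝ (EuclideanSpace ℝ (Fin n)) ℝ) :=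
    ((hF.continuous_fderiv (by simp)).comp (by fun_prop)).clm_comp continuous_const
  have heuler : euler (fun x => ∫ s in (0 : ℝ)..1, F (x, s)) x =
      ∫ s in (0 : ℝ)..1, s ^ (n - 1) * (s ^ 2 * fderiv ℝ w (s ^ 2 • x) x) := by
    rw [euler, (hasFDerivAt_parametric_intervalIntegral hF 0 1 x).fderiv,
      ContinuousLinearMap.intervalIntegral_apply (hcont.intervalIntegrable 0 1)]
    simp [hpart]
  have hpow : ∀ s : ℝ, s ^ n = s * s ^ (n - 1) := fun s => by
    rw [← pow_succ', Nat.sub_add_cancel hn]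
  have hder : ∀ s : ℝ, HasDerivAt (fun s : ℝ => s ^ n * w (s ^ 2 • x))
      (n * (s ^ (n - 1) * w (s ^ 2 • x)) +
        2 * (s ^ (n - 1) * (s ^ 2 * fderiv ℝ w (s ^ 2 • x) x))) s := fun s => by
    have h1 : HasDerivAt (fun s : ℝ => s ^ 2 • x) ((2 * s) • x) s := by
      simpa using (hasDerivAt_pow 2 s).smul_const x
    have h2 := (hasDerivAt_pow n s).mul ((dw (s ^ 2 • x)).hasFDerivAt.comp_hasDerivAt s h1)
    refine h2.congr_deriv ?_
    rw [map_smul, smul_eq_mul, hpow]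
    simp only [Function.comp_apply]
    ring
  have hi1 : Continuous fun s : ℝ => s ^ (n - 1) * w (s ^ 2 • x) :=
    hF.continuous.comp (by fun_prop : Continuous fun s : ℝ => (x, s))
  have hi2 : Continuous fun s : ℝ => s ^ (n - 1) * (s ^ 2 * fderiv ℝ w (s ^ 2 • x) x) := by
    fun_prop
  have hftc := intervalIntegral.integral_eq_sub_of_hasDerivAt (a := 0) (b := 1)
    (fun s _ => hder s)
    (((hi1.const_mul _).add (hi2.const_mul _)).intervalIntegrable 0 1)
  rw [intervalIntegral.integral_add ((hi1.const_mul _).intervalIntegrable 0 1)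
    ((hi2.const_mul _).intervalIntegrable 0 1), intervalIntegral.integral_const_mul,
    intervalIntegral.integral_const_mul] at hftc
  rw [heuler, hftc]
  simp [hn.ne']

theorem exists_almansi_decomposition (hn : 0 < n) {u : EuclideanSpace ℝ (Fin n) → ℝ}
    (hu : ContDiff ℝ ∞ u) (hlap : ∀ x ∈ ball (0 : EuclideanSpace ℝ (Fin n)) 1, lap (lap u) x = 0) :
    ∃ h q : EuclideanSpace ℝ (Fin n) → ℝ, ContDiff ℝ ∞ h ∧ ContDiff ℝ ∞ q ∧
      (u = fun x => h x + (1 - ‖x‖ ^ 2) * q x) ∧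
      (∀ x ∈ ball (0 : EuclideanSpace ℝ (Fin n)) 1, lap h x = 0) ∧
      (∀ x ∈ ball (0 : EuclideanSpace ℝ (Fin n)) 1, lap q x = 0) ∧
      lap u = fun x => -2 * n * q x - 4 * euler q x := by
  obtain ⟨q, hq, hqw⟩ := exists_contDiff_mul_add_two_mul_euler_eq hn
    (contDiff_const.mul hu.lap : ContDiff ℝ ∞ fun x => (-1 / 2 : ℝ) * lap u x)
  have hw : lap u = fun x => -2 * n * q x - 4 * euler q x := funext fun x => by
    linear_combination 2 * hqw x
  have hlapq : ∀ x ∈ ball (0 : EuclideanSpace ℝ (Fin n)) 1, lap q x = 0 := by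
    refine eqOn_ball_zero_of_fderiv_apply_self_eq
      ((-(n + 4) / 2 : ℝ) • ContinuousLinearMap.id ℝ ℝ) (fun j v hv => ?_) hq.lap fun x hx => ?_
    · simp only [smul_apply, ContinuousLinearMap.id_apply, smul_eq_mul] at hv
      have : ((j : ℝ) + (n + 4) / 2) * v = 0 := by linear_combination -hv
      exact (mul_eq_zero.1 this).resolve_left (by positivity)
    · have h0 := hlap x hx
      rw [hw, show (fun x => -2 * n * q x - 4 * euler q x) =
        fun x => (-2 * n) * q x + (-4) * euler q x from funext fun x => by ring,
        lap_add (contDiff_const.mul hq) (contDiff_const.mul hq.euler), lap_const_mul _ hq,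
        lap_const_mul _ hq.euler, lap_euler hq] at h0
      simp only [smul_apply, ContinuousLinearMap.id_apply, smul_eq_mul]
      change euler (lap q) x = _
      linear_combination -h0 / 4
  have hb : ContDiff ℝ ∞ fun x => (1 - ‖x‖ ^ 2) * q x := contDiff_one_sub_norm_sq.mul hq
  refine ⟨fun x => u x + (-1) * ((1 - ‖x‖ ^ 2) * q x), q, hu.add (contDiff_const.mul hb), hq,
    funext fun x => by ring, fun x hx => ?_, hlapq, hw⟩
  rw [lap_add hu (contDiff_const.mul hb), lap_const_mul _ hb, lap_one_sub_norm_sq_mul hq, hw]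
  simp only [hlapq x hx]
  ring

theorem eqOn_ball_zero_of_euler_cubic_eq {h : EuclideanSpace ℝ (Fin n) → ℝ}
    (hh : ContDiff ℝ ∞ h) (a b c : ℝ)
    (hroot : ∀ j : ℕ, (j : ℝ) ^ 3 ≠ a + b * j + c * j ^ 2)
    (heq : ∀ x ∈ ball (0 : EuclideanSpace ℝ (Fin n)) 1,
      euler (euler (euler h)) x = a * h x + b * euler h x + c * euler (euler h) x) :
    ∀ x ∈ ball (0 : EuclideanSpace ℝ (Fin n)) 1, h x = 0 := by
  set A : EuclideanSpace ℝ (Fin 3) →L[ℝ] EuclideanSpace ℝ (Fin 3) := LinearMap.toContinuousLinearMap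
    { toFun := fun v => !₂[v 1, v 2, a * v 0 + b * v 1 + c * v 2]
      map_add' := fun v w => by
        ext i
        fin_cases i <;> simp
        ring
      map_smul' := fun r v => by
        ext i
        fin_cases i <;> simp
        ring } with hA
  have hAv : ∀ v, A v = !₂[v 1, v 2, a * v 0 + b * v 1 + c * v 2] := fun v => rfl
  set V : EuclideanSpace ℝ (Fin n) → EuclideanSpace ℝ (Fin 3) :=
    fun x => !₂[h x, euler h x, euler (euler h) x] with hV
  have hVs : ContDiff ℝ ∞ V := by
    refine contDiff_euclidean.2 fun i => ?_
    fin_cases i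
    exacts [hh, hh.euler, hh.euler.euler]
  intro x hx
  suffices hVx : V x = 0 by simpa [hV] using congrArg (fun v => v 0) hVx
  refine eqOn_ball_zero_of_fderiv_apply_self_eq A (fun j v hv => ?_) hVs (fun y hy => ?_) x hx
  · rw [hAv] at hv
    have h0 : v 1 = j * v 0 := by simpa using congrArg (fun v => v 0) hv
    have h1 : v 2 = j * v 1 := by simpa using congrArg (fun v => v 1) hv
    have h2 : a * v 0 + b * v 1 + c * v 2 = j * v 2 := by simpa using congrArg (fun v => v 2) hv
    have hv0 : v 0 = 0 := by
      have : ((j : ℝ) ^ 3 - (a + b * j + c * j ^ 2)) * v 0 = 0 := by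
        rw [h1, h0] at h2
        linear_combination -h2
      exact (mul_eq_zero.1 this).resolve_left (sub_ne_zero.2 (hroot j))
    ext i
    fin_cases i <;> simp [h1, h0, hv0]
  · have hcoord : ∀ i, fderiv ℝ V y y i = euler (fun z => V z i) y := fun i => by
      have := ((EuclideanSpace.proj (𝕜 := ℝ) i).hasFDerivAt (x := V y)).comp y
        (hVs.differentiable (by simp) y).hasFDerivAt
      rw [euler, show fderiv ℝ (fun z => V z i) y = _ from this.fderiv]
      rfl
    ext i
    rw [hcoord, hAv]
    fin_cases i
    · rfl
    · rfl
    · exact heq y hy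

end Decomposition

section Wentzell

variable {n : ℕ}

theorem exists_contDiff_eventuallyEq {E : Type*} [NormedAddCommGroup E] [InnerProductSpace ℝ E]
    [FiniteDimensional ℝ E] {U : Set E} {u : E → ℝ} (hU : IsOpen U)
    (hBU : closedBall (0 : E) 1 ⊆ U) (hu : ContDiffOn ℝ ∞ u U) :
    ∃ v : E → ℝ, ContDiff ℝ ∞ v ∧ ∀ x ∈ closedBall (0 : E) 1, u =ᶠ[nhds x] v := by
  obtain ⟨δ, hδ, hδU⟩ := (isCompact_closedBall (0 : E) 1).exists_cthickening_subset_open hU hBU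
  rw [cthickening_closedBall hδ.le zero_le_one] at hδU
  let χ : ContDiffBump (0 : E) := ⟨1 + δ / 2, 1 + δ, by positivity, by linarith⟩
  refine ⟨fun x => χ x * u x, contDiff_iff_contDiffAt.2 fun x => ?_, fun x hx => ?_⟩
  · by_cases hx : x ∈ U
    · exact χ.contDiff.contDiffAt.mul (hu.contDiffAt (hU.mem_nhds hx))
    · have hx' : x ∉ tsupport χ := fun h => hx (hδU (by
        rw [χ.tsupport_eq] at h
        simpa [χ, add_comm] using h))
      refine (contDiffAt_const (c := (0 : ℝ))).congr_of_eventuallyEq ?_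
      filter_upwards [notMem_tsupport_iff_eventuallyEq.1 hx'] with y hy
      simp [hy]
  · have hxb : x ∈ ball (0 : E) χ.rIn := by
      rw [mem_ball_zero_iff]
      exact (mem_closedBall_zero_iff.1 hx).trans_lt (by simp only [χ]; linarith)
    filter_upwards [χ.eventuallyEq_one_of_mem_ball hxb] with y hy
    simp [hy]

theorem eqOn_ball_zero_of_wentzell (hn : 0 < n) {β ς : ℝ}
    (hς : ∀ k : ℕ, ς ≠ (k : ℝ) ^ 2 * (n + 2 * k) + β * k * (k + n - 2))
    {u : EuclideanSpace ℝ (Fin n) → ℝ} (hu : ContDiff ℝ ∞ u)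
    (hlap : ∀ x ∈ ball (0 : EuclideanSpace ℝ (Fin n)) 1, lap (lap u) x = 0)
    (hN : ∀ y : EuclideanSpace ℝ (Fin n), ‖y‖ = 1 → euler u y = 0)
    (hW : ∀ y : EuclideanSpace ℝ (Fin n), ‖y‖ = 1 →
      euler (lap u) y + β * (lap u y - euler (euler u) y) + ς * u y = 0) :
    ∀ x ∈ ball (0 : EuclideanSpace ℝ (Fin n)) 1, u x = 0 := by
  obtain ⟨h, q, hh, hq, huhq, hlh, hlq, hlu⟩ := exists_almansi_decomposition hn hu hlap
  have hb : ContDiff ℝ ∞ fun x => (1 - ‖x‖ ^ 2) * q x := contDiff_one_sub_norm_sq.mul hq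
  have lapEuler : ∀ {f : EuclideanSpace ℝ (Fin n) → ℝ}, ContDiff ℝ ∞ f →
      (∀ x ∈ ball (0 : EuclideanSpace ℝ (Fin n)) 1, lap f x = 0) →
      ∀ x ∈ ball (0 : EuclideanSpace ℝ (Fin n)) 1, lap (euler f) x = 0 := fun {f} hf hlf x hx => by
    have h0 : lap f =ᶠ[nhds x] fun _ => 0 :=
      Filter.eventually_of_mem (isOpen_ball.mem_nhds hx) hlf
    have h1 : euler (lap f) x = 0 := by simpa [euler] using h0.euler.eq_of_nhds
    rw [lap_euler hf]
    simp [h1, hlf x hx]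
  have hE : euler u = fun x => euler h x + euler (fun x => (1 - ‖x‖ ^ 2) * q x) x := by
    rw [huhq, euler_add hh hb]
  have hqh : ∀ x ∈ closedBall (0 : EuclideanSpace ℝ (Fin n)) 1, q x + (-1 / 2) * euler h x = 0 := by
    refine eqOn_closedBall_zero_of_lap_eq_zero (hq.add (contDiff_const.mul hh.euler)) hn
      (fun x hx => ?_) fun x hx => ?_
    · rw [lap_add hq (contDiff_const.mul hh.euler), lap_const_mul _ hh.euler]
      simp [hlq x hx, lapEuler hh hlh x hx]
    · have h0 := hN x hx
      rw [hE, euler_one_sub_norm_sq_mul hq] at h0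
      simp only [hx] at h0
      linear_combination -h0 / 2
  have hqh' : ∀ x ∈ ball (0 : EuclideanSpace ℝ (Fin n)) 1, q =ᶠ[nhds x] fun x =>
      (1 / 2 : ℝ) * euler h x := fun x hx => by
    filter_upwards [isOpen_ball.mem_nhds hx] with y hy
    linear_combination hqh y (ball_subset_closedBall hy)
  have hEq : ∀ x ∈ ball (0 : EuclideanSpace ℝ (Fin n)) 1, euler q =ᶠ[nhds x] fun x =>
      (1 / 2 : ℝ) * euler (euler h) x := fun x hx => by
    have := (hqh' x hx).euler
    rwa [euler_const_mul _ hh.euler] at this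
  have hEEq : ∀ x ∈ ball (0 : EuclideanSpace ℝ (Fin n)) 1, euler (euler q) x =
      (1 / 2 : ℝ) * euler (euler (euler h)) x := fun x hx => by
    have := (hEq x hx).euler.eq_of_nhds
    rwa [euler_const_mul _ hh.euler.euler] at this
  have hElu : euler (lap u) = fun x => (-2 * n) * euler q x + (-4) * euler (euler q) x := by
    rw [hlu, show (fun x => -2 * n * q x - 4 * euler q x) =
      fun x => (-2 * n) * q x + (-4) * euler q x from funext fun x => by ring,
      euler_add (contDiff_const.mul hq) (contDiff_const.mul hq.euler), euler_const_mul _ hq,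
      euler_const_mul _ hq.euler]
  have hEEu : ∀ y : EuclideanSpace ℝ (Fin n), ‖y‖ = 1 →
      euler (euler u) y = euler (euler h) y - 4 * euler q y - 4 * q y := fun y hy => by
    rw [hE, euler_add hh.euler hb.euler]
    beta_reduce
    rw [euler_euler_one_sub_norm_sq_mul hq hy]
    ring
  -- The boundary condition, written through harmonic functions only.
  have hZ : ∀ x ∈ closedBall (0 : EuclideanSpace ℝ (Fin n)) 1,
      ((-4) * euler (euler q) x + (-2 * n) * euler q x) +
        (β * (4 - 2 * n) * q x + ((-β) * euler (euler h) x + ς * h x)) = 0 := by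
    have c1 := (contDiff_const (c := (-4 : ℝ))).mul hq.euler.euler
    have c2 := (contDiff_const (c := (-2 * n : ℝ))).mul hq.euler
    have c3 := (contDiff_const (c := (β * (4 - 2 * n) : ℝ))).mul hq
    have c4 := (contDiff_const (c := (-β : ℝ))).mul hh.euler.euler
    have c5 := (contDiff_const (c := ς)).mul hh
    refine eqOn_closedBall_zero_of_lap_eq_zero ((c1.add c2).add (c3.add (c4.add c5))) hn
      (fun x hx => ?_) fun x hx => ?_
    · rw [lap_add (c1.add c2) (c3.add (c4.add c5)), lap_add c1 c2, lap_add c3 (c4.add c5),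
        lap_add c4 c5, lap_const_mul _ hq.euler.euler, lap_const_mul _ hq.euler,
        lap_const_mul _ hq, lap_const_mul _ hh.euler.euler, lap_const_mul _ hh]
      simp [hlh x hx, hlq x hx, lapEuler hq hlq x hx, lapEuler hh.euler (lapEuler hh hlh) x hx,
        lapEuler hq.euler (lapEuler hq hlq) x hx]
    · have h0 := hW x hx
      rw [hEEu x hx, hElu, hlu, huhq] at h0
      simp only [hx] at h0
      linear_combination h0
  have hh0 : ∀ x ∈ ball (0 : EuclideanSpace ℝ (Fin n)) 1, h x = 0 := by
    refine eqOn_ball_zero_of_euler_cubic_eq hh (ς / 2) (-β * (n - 2) / 2) (-(n + β) / 2)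
      (fun j hj => hς j (by linear_combination -2 * hj)) fun x hx => ?_
    have h0 := hZ x (ball_subset_closedBall hx)
    rw [hEEq x hx, (hEq x hx).eq_of_nhds, (hqh' x hx).eq_of_nhds] at h0
    linear_combination -h0 / 2
  intro x hx
  have h0 : h =ᶠ[nhds x] fun _ => 0 := Filter.eventually_of_mem (isOpen_ball.mem_nhds hx) hh0
  have h1 : euler h x = 0 := by simpa [euler] using h0.euler.eq_of_nhds
  have h2 := (hqh' x hx).eq_of_nhds
  rw [huhq]
  simp [hh0 x hx, h2, h1]

theorem exists_harmonic_homogeneous (hn : 2 ≤ n) (k : ℕ) :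
    ∃ H : EuclideanSpace ℝ (Fin n) → ℝ, ContDiff ℝ ∞ H ∧ (∀ x, lap H x = 0) ∧
      (∀ x, euler H x = k * H x) ∧ ∃ x, ‖x‖ = 1 ∧ H x = 1 := by
  let i0 : Fin n := ⟨0, by omega⟩
  let i1 : Fin n := ⟨1, by omega⟩
  have hi : i0 ≠ i1 := by simp [i0, i1]
  let ℓ : EuclideanSpace ℝ (Fin n) →L[ℝ] ℂ :=
    Complex.ofRealCLM.comp (EuclideanSpace.proj i0) +
      (EuclideanSpace.proj i1 : EuclideanSpace ℝ (Fin n) →L[ℝ] ℝ).smulRight Complex.I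
  have hℓ : ∀ x, ℓ x = x i0 + x i1 * Complex.I := fun x => by simp [ℓ]
  have hpow : ∀ (c : ℂ) (m : ℕ) (x v : EuclideanSpace ℝ (Fin n)),
      fderiv ℝ (fun y => (c * ℓ y ^ m).re) x v = (c * (m * ℓ x ^ (m - 1) * ℓ v)).re := by
    intro c m x v
    have h1 : HasFDerivAt (fun y => ℓ y ^ m) _ x := ℓ.hasFDerivAt.pow m
    have h2 := Complex.reCLM.hasFDerivAt.comp x (h1.const_mul c)
    rw [show fderiv ℝ (fun y => (c * ℓ y ^ m).re) x = _ from h2.fderiv]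
    simp
  have hsum : ∑ i, ℓ (EuclideanSpace.single i 1) ^ 2 = 0 := by
    have : ∀ i, ℓ (EuclideanSpace.single i 1) ^ 2 =
        (if i = i0 then (1 : ℂ) else 0) + if i = i1 then (-1 : ℂ) else 0 := fun i => by
      rw [hℓ]
      by_cases h0 : i = i0
      · subst h0
        simp [hi, hi.symm]
      · by_cases h1 : i = i1
        · subst h1
          simp [hi, hi.symm]
        · simp [h0, h1, Ne.symm h0, Ne.symm h1, eq_comm]
    simp [this, Finset.sum_add_distrib]
  refine ⟨fun x => ((1 : ℂ) * ℓ x ^ k).re, ?_, fun x => ?_, fun x => ?_,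
    EuclideanSpace.single i0 1, by simp, by simp [hℓ, hi]⟩
  · exact Complex.reCLM.contDiff.comp (contDiff_const.mul (ℓ.contDiff.pow k))
  · have h2 : ∀ i, fderiv ℝ (fun y => fderiv ℝ (fun x => ((1 : ℂ) * ℓ x ^ k).re) y
        (EuclideanSpace.single i 1)) x (EuclideanSpace.single i 1) =
        (k * (k - 1 : ℕ) * ℓ x ^ (k - 1 - 1) * ℓ (EuclideanSpace.single i 1) ^ 2).re := fun i => by
      rw [show (fun y => fderiv ℝ (fun x => ((1 : ℂ) * ℓ x ^ k).re) y
        (EuclideanSpace.single i 1)) = fun y =>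
          ((k * ℓ (EuclideanSpace.single i 1)) * ℓ y ^ (k - 1)).re from funext fun y => by
            rw [hpow]; congr 1; ring, hpow]
      congr 1
      ring
    simp only [lap, h2]
    rw [← Complex.re_sum, ← Finset.mul_sum, hsum]
    simp
  · rw [euler, hpow]
    rcases k with - | k
    · simp
    · rw [mul_assoc, ← pow_succ, Nat.add_sub_cancel, one_mul]
      simp only [one_mul]
      exact_mod_cast Complex.re_ofReal_mul (k + 1 : ℕ) _

theorem exists_wentzell_eigenfunction (hn : 2 ≤ n) (β : ℝ) (k : ℕ) :
    ∃ u : EuclideanSpace ℝ (Fin n) → ℝ, ContDiff ℝ ∞ u ∧ (∃ x, ‖x‖ = 1 ∧ u x ≠ 0) ∧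
      (∀ x, lap (lap u) x = 0) ∧ (∀ y, ‖y‖ = 1 → euler u y = 0) ∧
      ∀ y, ‖y‖ = 1 → euler (lap u) y + β * (lap u y - euler (euler u) y) +
        ((k : ℝ) ^ 2 * (n + 2 * k) + β * k * (k + n - 2)) * u y = 0 := by
  obtain ⟨H, hH, hlap, heuler, x₀, hx₀, hHx₀⟩ := exists_harmonic_homogeneous hn k
  have hE : euler H = fun x => k * H x := funext heuler
  have hL : lap H = fun _ => 0 := funext hlap
  have h2 : ContDiff ℝ ∞ fun x => 2 * H x := contDiff_const.mul hH
  have hk : ContDiff ℝ ∞ fun x => k * H x := contDiff_const.mul hH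
  have hb : ContDiff ℝ ∞ fun x => (1 - ‖x‖ ^ 2) * (k * H x) := contDiff_one_sub_norm_sq.mul hk
  have hlu : lap (fun x => 2 * H x + (1 - ‖x‖ ^ 2) * (k * H x)) =
      fun x => (-2 * n * k - 4 * k ^ 2) * H x := by
    rw [lap_add h2 hb, lap_const_mul _ hH, lap_one_sub_norm_sq_mul hk, lap_const_mul _ hH,
      euler_const_mul _ hH, hL, hE]
    funext x
    ring
  have hEu : euler (fun x => 2 * H x + (1 - ‖x‖ ^ 2) * (k * H x)) =
      fun x => 2 * k * H x + euler (fun x => (1 - ‖x‖ ^ 2) * (k * H x)) x := by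
    rw [euler_add h2 hb, euler_const_mul _ hH, hE]
    funext x
    ring
  refine ⟨fun x => 2 * H x + (1 - ‖x‖ ^ 2) * (k * H x), h2.add hb, ⟨x₀, hx₀, by simp [hx₀, hHx₀]⟩,
    fun x => ?_, fun y hy => ?_, fun y hy => ?_⟩
  · rw [hlu, lap_const_mul _ hH]
    simp [hlap x]
  · rw [hEu, euler_one_sub_norm_sq_mul hk]
    simp only [hy]
    ring
  · rw [hlu, hEu, euler_add (contDiff_const.mul hH) hb.euler]
    beta_reduce
    rw [euler_euler_one_sub_norm_sq_mul hk hy, euler_const_mul _ hH, euler_const_mul _ hH,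
      euler_const_mul _ hH, hE]
    simp only [hy]
    ring

end Wentzell

/-- Theorem 1.5(i): For `n ≥ 2` and `β ≥ 0`, a real number `ς` is an
eigenvalue of the Wentzell bi-Laplace problem on the unit ball — i.e., there is a nonzero
smooth function `u` on an open set containing the closed unit ball with `Δ²u = 0` in `𝔹`,
`ℰu = 0` on `∂𝔹` and `ℰ(Δu) + β(Δu - ℰ²u) + ς·u = 0` on `∂𝔹` — if and only if
`ς = k²(n+2k) + βk(k+n-2)` for some nonnegative integer `k`. -/
theorem wentzell_eigenvalues (n : ℕ) (hn : 2 ≤ n) (β ς : ℝ) (hβ : 0 ≤ β) :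
    (∃ (U : Set (EuclideanSpace ℝ (Fin n))) (u : EuclideanSpace ℝ (Fin n) → ℝ),
      IsOpen U ∧ Metric.closedBall (0 : EuclideanSpace ℝ (Fin n)) 1 ⊆ U ∧
      ContDiffOn ℝ (⊤ : ℕ∞) u U ∧
      (∃ x ∈ Metric.closedBall (0 : EuclideanSpace ℝ (Fin n)) 1, u x ≠ 0) ∧
      (∀ x ∈ Metric.ball (0 : EuclideanSpace ℝ (Fin n)) 1, lap (lap u) x = 0) ∧
      (∀ y : EuclideanSpace ℝ (Fin n), ‖y‖ = 1 → euler u y = 0) ∧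
      (∀ y : EuclideanSpace ℝ (Fin n), ‖y‖ = 1 →
        euler (lap u) y + β * (lap u y - euler (euler u) y) + ς * u y = 0)) ↔
    ∃ k : ℕ, ς = (k : ℝ) ^ 2 * ((n : ℝ) + 2 * (k : ℝ)) +
      β * (k : ℝ) * ((k : ℝ) + (n : ℝ) - 2) := by
  constructor
  · rintro ⟨U, u, hU, hBU, hu, ⟨x₀, hx₀, hux₀⟩, hlap, hN, hW⟩
    by_contra! hς
    obtain ⟨v, hv, huv⟩ := exists_contDiff_eventuallyEq hU hBU hu
    have hsphere : ∀ y : EuclideanSpace ℝ (Fin n), ‖y‖ = 1 → u =ᶠ[nhds y] v := fun y hy =>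
      huv y (mem_closedBall_zero_iff.2 hy.le)
    have hv0 := eqOn_ball_zero_of_wentzell (by omega) hς hv
      (fun x hx => (huv x (ball_subset_closedBall hx)).lap.lap.eq_of_nhds ▸ hlap x hx)
      (fun y hy => (hsphere y hy).euler.eq_of_nhds ▸ hN y hy) fun y hy => by
        rw [← (hsphere y hy).lap.euler.eq_of_nhds, ← (hsphere y hy).lap.eq_of_nhds,
          ← (hsphere y hy).euler.euler.eq_of_nhds, ← (hsphere y hy).eq_of_nhds]
        exact hW y hy
    have hcl : closure (ball (0 : EuclideanSpace ℝ (Fin n)) 1) ⊆ {x | v x = 0} :=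
      closure_minimal hv0 (isClosed_eq hv.continuous continuous_const)
    rw [closure_ball _ one_ne_zero] at hcl
    exact hux₀ ((huv x₀ hx₀).eq_of_nhds.trans (hcl hx₀))
  · rintro ⟨k, rfl⟩
    obtain ⟨u, hu, ⟨x₀, hx₀, hux₀⟩, hlap, hN, hW⟩ := exists_wentzell_eigenfunction hn β k
    exact ⟨univ, u, isOpen_univ, subset_univ _, hu.contDiffOn,
      ⟨x₀, mem_closedBall_zero_iff.2 hx₀.le, hux₀⟩, fun x _ => hlap x, hN, hW⟩
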